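/- Let G be a finite simple graph with maximum degree Δ that is (Δ+1)-list-edge-critical, and let a be a natural number with 3 ≤ a ≤ ⌊Δ/2 + 1⌋. Then 2·∑_{i=3}^{a} |V_i| < ∑_{j=Δ−a+3}^{Δ} (a + j − Δ − 2)·|V_j|. -/

import Mathlib

open scoped Classical

/-- A proper edge-coloring of `G` from the lists `L`: every edge receives a color
from its list, and distinct edges sharing a vertex receive distinct colors. -/
def IsProperListEdgeColoring {V : Type*} (G : SimpleGraph V)
    (L : Sym2 V → Finset ℕ) (f : Sym2 V → ℕ) : Prop :=
  (∀ e ∈ G.edgeSet, f e ∈ L e) ∧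
    ∀ e₁ ∈ G.edgeSet, ∀ e₂ ∈ G.edgeSet, e₁ ≠ e₂ → (∃ v, v ∈ e₁ ∧ v ∈ e₂) →
      f e₁ ≠ f e₂

/-- `G` is `k`-list-edge-colorable: for every edge-list-assignment `L` with all
lists of size at least `k`, `G` has a proper edge-coloring from the lists. -/
def ListEdgeColorable {V : Type*} (G : SimpleGraph V) (k : ℕ) : Prop :=
  ∀ L : Sym2 V → Finset ℕ, (∀ e ∈ G.edgeSet, k ≤ (L e).card) →
    ∃ f : Sym2 V → ℕ, IsProperListEdgeColoring G L f

/-- The list-chromatic index: the least `k` such that `G` is `k`-list-edge-colorable. -/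
noncomputable def listChromaticIndex {V : Type*} (G : SimpleGraph V) : ℕ :=
  sInf {k | ListEdgeColorable G k}

/-- `G` is `k`-list-edge-critical: `χ'ₗ(G) > k` and `χ'ₗ(G - e) ≤ k` for every edge `e`. -/
def ListEdgeCritical {V : Type*} (G : SimpleGraph V) (k : ℕ) : Prop :=
  k < listChromaticIndex G ∧
    ∀ e ∈ G.edgeSet, listChromaticIndex (G.deleteEdges {e}) ≤ k

section Bipartite

open Finset

variable {ι α β : Type*}

/-- An integer labeling of the edges of a bipartite multigraph (with edge set `E` and endpoint
maps `l`, `r`) that is proper, and such that for every edge the number of smaller labels at its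
left endpoint plus the number of larger labels at its right endpoint is less than the larger
degree of its two endpoints. -/
def IsGalvinLabeling (l : ι → α) (r : ι → β) (E : Finset ι) (c : ι → ℤ) : Prop :=
  (∀ e ∈ E, ∀ e' ∈ E, e ≠ e' → (l e = l e' ∨ r e = r e') → c e ≠ c e') ∧
    ∀ e ∈ E, #{e' ∈ E | l e' = l e ∧ c e' < c e} + #{e' ∈ E | r e' = r e ∧ c e < c e'} <
      max #{e' ∈ E | l e' = l e} #{e' ∈ E | r e' = r e}

theorem IsGalvinLabeling.swap {l : ι → α} {r : ι → β} {E : Finset ι} {c : ι → ℤ}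
    (h : IsGalvinLabeling l r E c) : IsGalvinLabeling r l E (-c) := by
  refine ⟨fun e he e' he' hne h' => ?_, fun e he => ?_⟩
  · simpa using h.1 e he e' he' hne h'.symm
  · have := h.2 e he
    simp only [Pi.neg_apply, neg_lt_neg_iff]
    rwa [add_comm, max_comm]

/-- If `#B ≤ #A`, there is a nonempty matching with left endpoints in `A` that covers every
vertex of `B` adjacent to a covered left vertex. -/
theorem exists_matching_of_card_le (l : ι → α) (r : ι → β) (E : Finset ι) (A : Finset α)
    (B : Finset β) (hA : A.Nonempty) (hAE : ∀ u ∈ A, ∃ e ∈ E, l e = u) (hBA : #B ≤ #A) :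
    ∃ M ⊆ E, M.Nonempty ∧ Set.InjOn l M ∧ Set.InjOn r M ∧ (∀ e ∈ M, l e ∈ A) ∧
      ∀ e ∈ E, l e ∈ M.image l → r e ∈ B → r e ∈ M.image r := by
  set N : α → Finset β := fun u => {b ∈ B | ∃ e ∈ E, l e = u ∧ r e = b} with hN
  obtain ⟨S, hS, hmin⟩ := exists_min_image
    {S ∈ A.powerset | S.Nonempty ∧ #(S.biUnion N) ≤ #S} card
    ⟨A, by
      simp only [mem_filter, mem_powerset, subset_refl, true_and]
      refine ⟨hA, (card_le_card ?_).trans hBA⟩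
      exact biUnion_subset.2 fun u _ => filter_subset _ _⟩
  simp only [mem_filter, mem_powerset] at hS hmin
  obtain ⟨hSA, hSne, hScard⟩ := hS
  rcases hScard.lt_or_eq with hlt | heq
  · obtain ⟨u, hu⟩ := hSne
    have hSu : S = {u} := by
      by_contra hne
      have h1 : (S.erase u).Nonempty := by
        rw [nonempty_iff_ne_empty]
        intro h0
        rcases (erase_eq_empty_iff _ _).1 h0 with h | h
        · simp [h] at hu
        · exact hne h
      have h2 : #(S.erase u) = #S - 1 := card_erase_of_mem hu
      have h3 : #((S.erase u).biUnion N) ≤ #(S.biUnion N) :=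
        card_le_card (biUnion_subset_biUnion_of_subset_left _ (erase_subset _ _))
      have h4 := hmin (S.erase u) ⟨(erase_subset _ _).trans hSA, h1, by omega⟩
      have := card_pos.2 ⟨u, hu⟩
      omega
    subst hSu
    have hNu : N u = ∅ := by simpa using hlt
    obtain ⟨e, he, hel⟩ := hAE u (hSA hu)
    refine ⟨{e}, by simpa using he, by simp, by simp, by simp, ?_, ?_⟩
    · simp only [mem_singleton, forall_eq]
      exact hel ▸ hSA hu
    · intro e' he' hl hB
      have : r e' ∈ N u := by
        simp only [hN, mem_filter]
        exact ⟨hB, e', he', by simpa [hel] using hl, rfl⟩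
      simp [hNu] at this
  · have hall : ∀ T : Finset S, #T ≤ #(T.biUnion fun u => N u) := by
      intro T
      by_contra! hT
      have hcT : #(T.map (Function.Embedding.subtype _)) = #T := card_map _
      have hbT : (T.map (Function.Embedding.subtype _)).biUnion N = T.biUnion fun u => N u := by
        ext; simp
      have hTS : T.map (Function.Embedding.subtype _) ⊆ S := by
        intro x hx
        obtain ⟨y, _, rfl⟩ := mem_map.1 hx
        exact y.2
      have hTne : T.Nonempty := card_pos.1 (by omega)
      have := hmin _ ⟨hTS.trans hSA, hTne.map, by rw [hbT, hcT]; exact hT.le⟩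
      have hEq := eq_of_subset_of_card_le hTS this
      rw [← hbT, ← hcT, hEq] at hT
      omega
    obtain ⟨φ, hφ, hφN⟩ := (all_card_le_biUnion_card_iff_exists_injective fun u : S => N u).1 hall
    have hg : ∀ u : S, ∃ e ∈ E, l e = u ∧ r e = φ u := fun u => by
      have := hφN u
      simp only [hN, mem_filter] at this
      exact this.2
    choose g hgE hgl hgr using hg
    have hcov : univ.image φ = S.biUnion N := by
      apply eq_of_subset_of_card_le
      · intro b hb
        obtain ⟨u, _, rfl⟩ := mem_image.1 hb
        exact mem_biUnion.2 ⟨u, u.2, hφN u⟩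
      · rw [heq, card_image_of_injective _ hφ]
        simp
    refine ⟨univ.image g, ?_, ?_, ?_, ?_, ?_, ?_⟩
    · intro e he
      obtain ⟨u, _, rfl⟩ := mem_image.1 he
      exact hgE u
    · obtain ⟨u, hu⟩ := hSne
      exact ⟨g ⟨u, hu⟩, mem_image_of_mem _ (mem_univ _)⟩
    · intro e he e' he' h
      simp only [coe_image, coe_univ, Set.image_univ, Set.mem_range] at he he'
      obtain ⟨u, rfl⟩ := he
      obtain ⟨v, rfl⟩ := he'
      rw [hgl, hgl] at h
      rw [Subtype.ext h]
    · intro e he e' he' h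
      simp only [coe_image, coe_univ, Set.image_univ, Set.mem_range] at he he'
      obtain ⟨u, rfl⟩ := he
      obtain ⟨v, rfl⟩ := he'
      rw [hgr, hgr] at h
      rw [hφ h]
    · intro e he
      obtain ⟨u, _, rfl⟩ := mem_image.1 he
      rw [hgl]
      exact hSA u.2
    · intro e he hl hB
      obtain ⟨m, hm, hml⟩ := mem_image.1 hl
      obtain ⟨u, _, rfl⟩ := mem_image.1 hm
      have : r e ∈ univ.image φ := by
        rw [hcov]
        refine mem_biUnion.2 ⟨u, u.2, ?_⟩
        simp only [hN, mem_filter]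
        exact ⟨hB, e, he, by rw [← hml, hgl], rfl⟩
      obtain ⟨v, _, hv⟩ := mem_image.1 this
      exact mem_image.2 ⟨g v, mem_image_of_mem _ (mem_univ _), by rw [hgr, hv]⟩

theorem card_filter_sdiff_le (E M : Finset ι) (p : ι → Prop) [DecidablePred p] :
    #{x ∈ E \ M | p x} ≤ #{x ∈ E | p x} :=
  card_le_card (filter_subset_filter _ sdiff_subset)

theorem card_filter_sdiff_lt {E M : Finset ι} (hME : M ⊆ E) (p : ι → Prop) [DecidablePred p]
    (h : ∃ m ∈ M, p m) : #{x ∈ E \ M | p x} < #{x ∈ E | p x} := by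
  obtain ⟨m, hm, hpm⟩ := h
  refine card_lt_card ((ssubset_iff_of_subset
    (filter_subset_filter _ sdiff_subset)).2 ⟨m, ?_, ?_⟩)
  · simpa using ⟨hME hm, hpm⟩
  · simp [hm]

theorem exists_isGalvinLabeling_of_ssubset (l : ι → α) (r : ι → β) (E : Finset ι) (d : ℕ)
    (hr : ∀ e ∈ E, #{e' ∈ E | r e' = r e} ≤ d)
    (hne : {u ∈ E.image l | #{e' ∈ E | l e' = u} = d}.Nonempty)
    (hcard : #{w ∈ E.image r | #{e' ∈ E | r e' = w} = d} ≤
      #{u ∈ E.image l | #{e' ∈ E | l e' = u} = d})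
    (ih : ∀ E' ⊂ E, ∃ c, IsGalvinLabeling l r E' c) : ∃ c, IsGalvinLabeling l r E c := by
  obtain ⟨M, hME, hMne, hMl, hMr, hMA, hMB⟩ := exists_matching_of_card_le l r E _ _ hne
    (fun u hu => by simpa using (mem_filter.1 hu).1) hcard
  obtain ⟨c, hc, hrank⟩ := ih (E \ M) (sdiff_ssubset hME hMne)
  obtain ⟨K, hK⟩ := ((E \ M).image c).bddBelow
  have hK' : ∀ e ∈ E, e ∉ M → K ≤ c e := fun e he heM =>
    hK (mem_coe.2 (mem_image_of_mem _ (mem_sdiff.2 ⟨he, heM⟩)))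
  refine ⟨fun e => if e ∈ M then K - 1 else c e, ?_, ?_⟩
  · intro e he e' he' hne' hadj
    by_cases h : e ∈ M <;> by_cases h' : e' ∈ M
    · rcases hadj with h1 | h1
      · exact absurd (hMl h h' h1) hne'
      · exact absurd (hMr h h' h1) hne'
    · have := hK' e' he' h'
      simp only [h, h', if_true, if_false]
      omega
    · have := hK' e he h
      simp only [h, h', if_true, if_false]
      omega
    · simp only [h, h', if_false]
      exact hc e (mem_sdiff.2 ⟨he, h⟩) e' (mem_sdiff.2 ⟨he', h'⟩) hne' hadj
  · intro e he
    by_cases h : e ∈ M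
    · have h1 : {e' ∈ E | l e' = l e ∧ (if e' ∈ M then K - 1 else c e') <
          if e ∈ M then K - 1 else c e} = ∅ := by
        rw [filter_eq_empty_iff]
        rintro x hx ⟨-, hlt⟩
        by_cases hxM : x ∈ M
        · simp [h, hxM] at hlt
        · have := hK' x hx hxM
          simp only [h, hxM, if_true, if_false] at hlt
          omega
      rw [h1, card_empty, zero_add]
      refine lt_max_of_lt_right (card_lt_card ?_)
      rw [ssubset_iff_of_subset (fun x hx => by
        simp only [mem_filter] at hx ⊢; exact ⟨hx.1, hx.2.1⟩)]
      exact ⟨e, by simpa using he, by simp⟩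
    · have hrk := hrank e (mem_sdiff.2 ⟨he, h⟩)
      have h2 : {e' ∈ E | r e' = r e ∧ (if e ∈ M then K - 1 else c e) <
          if e' ∈ M then K - 1 else c e'} = {e' ∈ E \ M | r e' = r e ∧ c e < c e'} := by
        ext x
        have := hK' e he h
        by_cases hxM : x ∈ M
        · simp only [mem_filter, mem_sdiff, h, hxM, if_true, if_false]
          constructor
          · rintro ⟨-, -, h3⟩; omega
          · simp
        · simp [h, hxM]
      rw [h2]
      by_cases hcov : l e ∈ M.image l
      · obtain ⟨m, hm, hml⟩ := mem_image.1 hcov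
        have h1 : #{e' ∈ E | l e' = l e ∧ (if e' ∈ M then K - 1 else c e') <
            if e ∈ M then K - 1 else c e} ≤ #{e' ∈ E \ M | l e' = l e ∧ c e' < c e} + 1 := by
          refine (card_le_card ?_).trans (card_insert_le m _)
          intro x hx
          simp only [mem_filter, h, if_false] at hx
          by_cases hxM : x ∈ M
          · exact mem_insert.2 (Or.inl (hMl hxM hm (hx.2.1.trans hml.symm)))
          · simp only [hxM, if_false] at hx
            simp [hx.1, hxM, hx.2.1, hx.2.2]
        have hd : #{e' ∈ E | l e' = l e} = d := by
          rw [← hml]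
          exact (mem_filter.1 (hMA m hm)).2
        have hl' := card_filter_sdiff_lt hME (fun x => l x = l e) ⟨m, hm, hml⟩
        have hr' : #{e' ∈ E \ M | r e' = r e} < d := by
          rcases (hr e he).lt_or_eq with hlt | heq
          · exact (card_filter_sdiff_le E M _).trans_lt hlt
          · have := hMB e he hcov (mem_filter.2 ⟨mem_image_of_mem _ he, heq⟩)
            obtain ⟨m', hm', hmr⟩ := mem_image.1 this
            exact (card_filter_sdiff_lt hME (fun x => r x = r e) ⟨m', hm', hmr⟩).trans_eq heq
        beta_reduce
        omega
      · have h1 : {e' ∈ E | l e' = l e ∧ (if e' ∈ M then K - 1 else c e') <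
            if e ∈ M then K - 1 else c e} = {e' ∈ E \ M | l e' = l e ∧ c e' < c e} := by
          ext x
          by_cases hxM : x ∈ M
          · have : l x ≠ l e := fun hx => hcov (hx ▸ mem_image_of_mem _ hxM)
            simp [this]
          · simp [h, hxM]
        rw [h1]
        have := card_filter_sdiff_le E M (fun x => l x = l e)
        have := card_filter_sdiff_le E M (fun x => r x = r e)
        omega

theorem exists_isGalvinLabeling (l : ι → α) (r : ι → β) (E : Finset ι) :
    ∃ c, IsGalvinLabeling l r E c := by
  induction E using Finset.strongInduction with
  | H E ih =>
    rcases E.eq_empty_or_nonempty with rfl | hE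
    · exact ⟨0, by simp [IsGalvinLabeling]⟩
    obtain ⟨m, hm, hmax⟩ := exists_max_image E
      (fun e => max #{e' ∈ E | l e' = l e} #{e' ∈ E | r e' = r e}) hE
    set d := max #{e' ∈ E | l e' = l m} #{e' ∈ E | r e' = r m} with hd
    have hl : ∀ e ∈ E, #{e' ∈ E | l e' = l e} ≤ d := fun e he =>
      (le_max_left _ _).trans (hmax e he)
    have hr : ∀ e ∈ E, #{e' ∈ E | r e' = r e} ≤ d := fun e he =>
      (le_max_right _ _).trans (hmax e he)
    have hne : 0 < #{u ∈ E.image l | #{e' ∈ E | l e' = u} = d} ∨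
        0 < #{w ∈ E.image r | #{e' ∈ E | r e' = w} = d} := by
      rcases max_choice #{e' ∈ E | l e' = l m} #{e' ∈ E | r e' = r m} with h | h
      · exact Or.inl (card_pos.2 ⟨l m, mem_filter.2 ⟨mem_image_of_mem _ hm, (hd.trans h).symm⟩⟩)
      · exact Or.inr (card_pos.2 ⟨r m, mem_filter.2 ⟨mem_image_of_mem _ hm, (hd.trans h).symm⟩⟩)
    rcases le_total #{w ∈ E.image r | #{e' ∈ E | r e' = w} = d}
      #{u ∈ E.image l | #{e' ∈ E | l e' = u} = d} with hle | hle
    · exact exists_isGalvinLabeling_of_ssubset l r E d hr (card_pos.1 (by omega)) hle ih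
    · obtain ⟨c, hc⟩ := exists_isGalvinLabeling_of_ssubset r l E d hl
        (card_pos.1 (by omega)) hle fun E' hE' => (ih E' hE').imp' _ fun _ h => h.swap
      exact ⟨_, hc.swap⟩

/-- Existence of stable matchings, where left vertices prefer small labels and right vertices
prefer large labels. -/
theorem exists_stable_matching (l : ι → α) (r : ι → β) (c : ι → ℤ) (E : Finset ι)
    (hc : ∀ e ∈ E, ∀ e' ∈ E, e ≠ e' → (l e = l e' ∨ r e = r e') → c e ≠ c e') :
    ∃ M ⊆ E, Set.InjOn l M ∧ Set.InjOn r M ∧ ∀ e ∈ E, e ∉ M →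
      ∃ m ∈ M, (l m = l e ∧ c m < c e) ∨ (r m = r e ∧ c e < c m) := by
  induction E using Finset.strongInduction with
  | H E ih =>
    by_cases h : ∃ e ∈ E, ∃ e' ∈ E, r e = r e' ∧ c e < c e' ∧ ∀ x ∈ E, l x = l e' → c e' ≤ c x
    · obtain ⟨e, he, e', he', hr, hlt, hmin⟩ := h
      obtain ⟨M, hME, hMl, hMr, hM⟩ := ih (E.erase e) (erase_ssubset he)
        fun x hx y hy => hc x (mem_of_mem_erase hx) y (mem_of_mem_erase hy)
      refine ⟨M, hME.trans (erase_subset _ _), hMl, hMr, fun x hx hxM => ?_⟩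
      by_cases hxe : x = e
      · subst hxe
        by_cases he'M : e' ∈ M
        · exact ⟨e', he'M, Or.inr ⟨hr.symm, hlt⟩⟩
        · have hne : e' ≠ x := by
            rintro rfl
            exact lt_irrefl _ hlt
          obtain ⟨m, hm, h1 | h1⟩ := hM e' (mem_erase.2 ⟨hne, he'⟩) he'M
          · have := hmin m (mem_of_mem_erase (hME hm)) h1.1
            omega
          · exact ⟨m, hm, Or.inr ⟨h1.1.trans hr.symm, hlt.trans h1.2⟩⟩
      · exact hM x (mem_erase.2 ⟨hxe, hx⟩) hxM
    · push Not at h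
      refine ⟨{e ∈ E | ∀ x ∈ E, l x = l e → c e ≤ c x}, filter_subset _ _, ?_, ?_, ?_⟩
      · intro e he e' he' hl
        simp only [coe_filter, Set.mem_ofPred_eq] at he he'
        by_contra hne
        exact hc e he.1 e' he'.1 hne (Or.inl hl)
          (le_antisymm (he.2 e' he'.1 hl.symm) (he'.2 e he.1 hl))
      · intro e he e' he' hr
        simp only [coe_filter, Set.mem_ofPred_eq] at he he'
        by_contra hne
        rcases (hc e he.1 e' he'.1 hne (Or.inr hr)).lt_or_gt with hlt | hlt
        · obtain ⟨x, hx, hxl, hxc⟩ := h e he.1 e' he'.1 hr hlt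
          exact absurd (he'.2 x hx hxl) (not_le.2 hxc)
        · obtain ⟨x, hx, hxl, hxc⟩ := h e' he'.1 e he.1 hr.symm hlt
          exact absurd (he.2 x hx hxl) (not_le.2 hxc)
      · intro e he _
        obtain ⟨m, hm, hmin⟩ := exists_min_image {x ∈ E | l x = l e} c ⟨e, by simpa using he⟩
        simp only [mem_filter] at hm hmin
        by_cases hme : c m < c e
        · exact ⟨m, mem_filter.2 ⟨hm.1, fun x hx hxl => hmin x ⟨hx, hxl.trans hm.2⟩⟩,
            Or.inl ⟨hm.2, hme⟩⟩
        · rename_i heM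
          refine absurd (mem_filter.2 ⟨he, fun x hx hxl => ?_⟩) heM
          exact (not_lt.1 hme).trans (hmin x ⟨hx, hxl⟩)

theorem exists_list_coloring_of_labeling (l : ι → α) (r : ι → β) (c : ι → ℤ) (E : Finset ι)
    (hc : ∀ e ∈ E, ∀ e' ∈ E, e ≠ e' → (l e = l e' ∨ r e = r e') → c e ≠ c e')
    (L : ι → Finset ℕ)
    (hL : ∀ e ∈ E, #{e' ∈ E | l e' = l e ∧ c e' < c e} + #{e' ∈ E | r e' = r e ∧ c e < c e'} <
      #(L e)) :
    ∃ f : ι → ℕ, (∀ e ∈ E, f e ∈ L e) ∧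
      ∀ e ∈ E, ∀ e' ∈ E, e ≠ e' → (l e = l e' ∨ r e = r e') → f e ≠ f e' := by
  induction E using Finset.strongInduction generalizing L with
  | H E ih =>
    rcases E.eq_empty_or_nonempty with rfl | ⟨e₀, he₀⟩
    · exact ⟨0, by simp⟩
    obtain ⟨x, hx⟩ : (L e₀).Nonempty := card_pos.1 (by have := hL e₀ he₀; omega)
    obtain ⟨M, hME, hMl, hMr, hM⟩ := exists_stable_matching l r c {e ∈ E | x ∈ L e}
      fun e he e' he' => hc e (mem_filter.1 he).1 e' (mem_filter.1 he').1
    have hMne : M.Nonempty := by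
      by_cases h : e₀ ∈ M
      · exact ⟨e₀, h⟩
      · obtain ⟨m, hm, _⟩ := hM e₀ (mem_filter.2 ⟨he₀, hx⟩) h
        exact ⟨m, hm⟩
    have hME' : M ⊆ E := hME.trans (filter_subset _ _)
    obtain ⟨f, hfL, hf⟩ := ih (E \ M) (sdiff_ssubset hME' hMne)
      (fun e he e' he' => hc e (mem_sdiff.1 he).1 e' (mem_sdiff.1 he').1)
      (fun e => (L e).erase x) (by
        intro e he
        obtain ⟨heE, heM⟩ := mem_sdiff.1 he
        have h0 := hL e heE
        have h1 := card_filter_sdiff_le E M (fun e' => l e' = l e ∧ c e' < c e)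
        have h2 := card_filter_sdiff_le E M (fun e' => r e' = r e ∧ c e < c e')
        by_cases hxe : x ∈ L e
        · rw [card_erase_of_mem hxe]
          obtain ⟨m, hm, h | h⟩ := hM e (mem_filter.2 ⟨heE, hxe⟩) heM
          · have := card_filter_sdiff_lt hME' (fun e' => l e' = l e ∧ c e' < c e) ⟨m, hm, h⟩
            omega
          · have := card_filter_sdiff_lt hME' (fun e' => r e' = r e ∧ c e < c e') ⟨m, hm, h⟩
            omega
        · rw [erase_eq_of_notMem hxe]
          omega)
    refine ⟨fun e => if e ∈ M then x else f e, fun e he => ?_, fun e he e' he' hne hadj => ?_⟩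
    · by_cases h : e ∈ M
      · simpa [h] using (mem_filter.1 (hME h)).2
      · simpa [h] using mem_of_mem_erase (hfL e (mem_sdiff.2 ⟨he, h⟩))
    · by_cases h : e ∈ M <;> by_cases h' : e' ∈ M
      · rcases hadj with h1 | h1
        · exact absurd (hMl h h' h1) hne
        · exact absurd (hMr h h' h1) hne
      · simpa [h, h'] using (ne_of_mem_erase (hfL e' (mem_sdiff.2 ⟨he', h'⟩))).symm
      · simpa [h, h'] using ne_of_mem_erase (hfL e (mem_sdiff.2 ⟨he, h⟩))
      · simpa [h, h'] using hf e (mem_sdiff.2 ⟨he, h⟩) e' (mem_sdiff.2 ⟨he', h'⟩) hne hadj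

/-- The Borodin–Kostochka–Woodall theorem: a bipartite multigraph is edge-colorable from lists
in which the list of every edge has at least as many colors as the larger degree of its
endpoints. -/
theorem exists_list_coloring_of_max_degree_le (l : ι → α) (r : ι → β) (E : Finset ι)
    (L : ι → Finset ℕ)
    (hL : ∀ e ∈ E, max #{e' ∈ E | l e' = l e} #{e' ∈ E | r e' = r e} ≤ #(L e)) :
    ∃ f : ι → ℕ, (∀ e ∈ E, f e ∈ L e) ∧
      ∀ e ∈ E, ∀ e' ∈ E, e ≠ e' → (l e = l e' ∨ r e = r e') → f e ≠ f e' := by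
  obtain ⟨c, hc, hrank⟩ := exists_isGalvinLabeling l r E
  exact exists_list_coloring_of_labeling l r c E hc L fun e he =>
    (hrank e he).trans_le (hL e he)

end Bipartite

section Critical

open Finset

variable {V : Type*}

theorem ListEdgeColorable.anti {G G' : SimpleGraph V} {k : ℕ} (h : ListEdgeColorable G k)
    (hle : G' ≤ G) : ListEdgeColorable G' k := by
  intro L hL
  obtain ⟨f, hfL, hf⟩ := h (fun e => if e ∈ G'.edgeSet then L e else range k) fun e _ => by
    by_cases he : e ∈ G'.edgeSet
    · simpa [he] using hL e he
    · simp [he]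
  have hsub := SimpleGraph.edgeSet_mono hle
  refine ⟨f, fun e he => by simpa [he] using hfL e (hsub he), fun e he e' he' => ?_⟩
  exact hf e (hsub he) e' (hsub he')

theorem ListEdgeColorable.mono {G : SimpleGraph V} {k m : ℕ} (h : ListEdgeColorable G k)
    (hkm : k ≤ m) : ListEdgeColorable G m :=
  fun L hL => h L fun e he => hkm.trans (hL e he)

theorem ListEdgeCritical.not_colorable {G : SimpleGraph V} {k : ℕ} (h : ListEdgeCritical G k) :
    ¬ ListEdgeColorable G k := fun hc =>
  absurd (Nat.sInf_le (s := {k | ListEdgeColorable G k}) hc) (not_le.2 h.1)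

theorem ListEdgeCritical.colorable_of_le {G G' : SimpleGraph V} {k : ℕ}
    (h : ListEdgeCritical G k) {e : Sym2 V} (he : e ∈ G.edgeSet)
    (hG' : G' ≤ G.deleteEdges {e}) : ListEdgeColorable G' k := by
  have hne : {k | ListEdgeColorable G k}.Nonempty := by
    rw [Set.nonempty_iff_ne_empty]
    intro h0
    have := h.1
    simp [listChromaticIndex, h0] at this
  obtain ⟨m, hm⟩ := hne
  have hmem : ListEdgeColorable (G.deleteEdges {e}) (listChromaticIndex (G.deleteEdges {e})) :=
    Nat.sInf_mem (s := {k | ListEdgeColorable (G.deleteEdges {e}) k})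
      ⟨m, hm.anti (SimpleGraph.deleteEdges_le _)⟩
  exact (hmem.mono (h.2 e he)).anti hG'

/-- A critical graph contains no bipartite subgraph whose edges, after coloring the remaining
edges, always keep enough colors for the Borodin–Kostochka–Woodall theorem. -/
theorem ListEdgeCritical.exists_lt_of_bipartite [Fintype V] {G : SimpleGraph V}
    [DecidableRel G.Adj] {k : ℕ} (h : ListEdgeCritical G k) (A : Set V) (F : Finset (V × V))
    (hF : F.Nonempty) (hadj : ∀ p ∈ F, G.Adj p.1 p.2) (hA : ∀ p ∈ F, p.1 ∈ A)
    (hA' : ∀ p ∈ F, p.2 ∉ A) :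
    ∃ p ∈ F, k < max #{q ∈ F | q.1 = p.1} #{q ∈ F | q.2 = p.2} +
      (G.degree p.1 - #{q ∈ F | q.1 = p.1}) + (G.degree p.2 - #{q ∈ F | q.2 = p.2}) := by
  by_contra! hbig
  have hinj : ∀ p ∈ F, ∀ q ∈ F, s(p.1, p.2) = s(q.1, q.2) → p = q := by
    intro p hp q hq hpq
    rcases Sym2.eq_iff.1 hpq with h1 | h1
    · exact Prod.ext h1.1 h1.2
    · exact absurd (h1.1 ▸ hA p hp) (hA' q hq)
  refine h.not_colorable fun L hL => ?_
  set FE : Set (Sym2 V) := {e | ∃ p ∈ F, s(p.1, p.2) = e} with hFE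
  obtain ⟨p₀, hp₀⟩ := hF
  obtain ⟨f₀, hf₀L, hf₀⟩ := h.colorable_of_le (e := s(p₀.1, p₀.2)) (hadj p₀ hp₀)
    (SimpleGraph.deleteEdges_anti (s₁ := {s(p₀.1, p₀.2)}) (s₂ := FE)
      (by rintro _ rfl; exact ⟨p₀, hp₀, rfl⟩)) L fun e he =>
      hL e (SimpleGraph.edgeSet_mono (SimpleGraph.deleteEdges_le _) he)
  set R : V → Finset V := fun v => {x ∈ G.neighborFinset v | s(v, x) ∉ FE} with hR
  set X : V → Finset ℕ := fun v => (R v).image fun x => f₀ s(v, x) with hX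
  have hXmem : ∀ v, ∀ e ∈ (G.deleteEdges FE).edgeSet, v ∈ e → f₀ e ∈ X v := by
    intro v e he hv
    obtain ⟨x, rfl⟩ := Sym2.mem_iff_exists.1 hv
    rw [SimpleGraph.edgeSet_deleteEdges] at he
    refine mem_image.2 ⟨x, ?_, rfl⟩
    simp only [hR, mem_filter, SimpleGraph.mem_neighborFinset]
    exact ⟨he.1, he.2⟩
  have hcardR : ∀ v, ∀ T ⊆ G.neighborFinset v, (∀ x ∈ T, s(v, x) ∈ FE) →
      #(X v) ≤ G.degree v - #T := by
    intro v T hT hTF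
    refine card_image_le.trans ?_
    rw [← SimpleGraph.card_neighborFinset_eq_degree, ← card_sdiff_of_subset hT]
    refine card_le_card fun x hx => ?_
    simp only [hR, mem_filter] at hx
    exact mem_sdiff.2 ⟨hx.1, fun hxT => hx.2 (hTF x hxT)⟩
  have hX1 : ∀ p ∈ F, #(X p.1) ≤ G.degree p.1 - #{q ∈ F | q.1 = p.1} := by
    intro p hp
    have hc : #({q ∈ F | q.1 = p.1}.image Prod.snd) = #{q ∈ F | q.1 = p.1} := by
      refine card_image_of_injOn fun q hq q' hq' hqq => ?_
      simp only [coe_filter, Set.mem_ofPred_eq] at hq hq'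
      exact Prod.ext (hq.2.trans hq'.2.symm) hqq
    rw [← hc]
    refine hcardR _ _ (fun x hx => ?_) fun x hx => ?_ <;>
      obtain ⟨q, hq, rfl⟩ := mem_image.1 hx <;>
      obtain ⟨hq, hq1⟩ := mem_filter.1 hq <;> rw [← hq1]
    · simpa using hadj q hq
    · exact ⟨q, hq, rfl⟩
  have hX2 : ∀ p ∈ F, #(X p.2) ≤ G.degree p.2 - #{q ∈ F | q.2 = p.2} := by
    intro p hp
    have hc : #({q ∈ F | q.2 = p.2}.image Prod.fst) = #{q ∈ F | q.2 = p.2} := by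
      refine card_image_of_injOn fun q hq q' hq' hqq => ?_
      simp only [coe_filter, Set.mem_ofPred_eq] at hq hq'
      exact Prod.ext hqq (hq.2.trans hq'.2.symm)
    rw [← hc]
    refine hcardR _ _ (fun x hx => ?_) fun x hx => ?_ <;>
      obtain ⟨q, hq, rfl⟩ := mem_image.1 hx <;>
      obtain ⟨hq, hq1⟩ := mem_filter.1 hq <;> rw [← hq1]
    · simpa using (hadj q hq).symm
    · exact ⟨q, hq, Sym2.eq_swap⟩
  obtain ⟨g, hgL, hg⟩ := exists_list_coloring_of_max_degree_le Prod.fst Prod.snd F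
    (fun p => L s(p.1, p.2) \ (X p.1 ∪ X p.2)) (by
      intro p hp
      have h1 := hbig p hp
      have h2 := hL s(p.1, p.2) (hadj p hp)
      have h3 := le_card_sdiff (X p.1 ∪ X p.2) (L s(p.1, p.2))
      have h4 := card_union_le (X p.1) (X p.2)
      have h5 := hX1 p hp
      have h6 := hX2 p hp
      omega)
  have hgX : ∀ p ∈ F, ∀ v ∈ s(p.1, p.2), g p ∉ X v := by
    intro p hp v hv
    have h1 := hgL p hp
    simp only [mem_sdiff, mem_union, not_or] at h1
    rcases Sym2.mem_iff.1 hv with rfl | rfl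
    · exact h1.2.1
    · exact h1.2.2
  have hrep : ∀ e : Sym2 V, ∃ c, (∀ p ∈ F, s(p.1, p.2) = e → c = g p) ∧ (e ∉ FE → c = f₀ e) := by
    intro e
    by_cases he : e ∈ FE
    · obtain ⟨p, hp, hpe⟩ := he
      exact ⟨g p, fun q hq hqe => by rw [hinj p hp q hq (hpe.trans hqe.symm)],
        fun h' => absurd ⟨p, hp, hpe⟩ h'⟩
    · exact ⟨f₀ e, fun p hp hpe => absurd ⟨p, hp, hpe⟩ he, fun _ => rfl⟩
  choose f hfg hff using hrep
  have hrest : ∀ e ∈ G.edgeSet, e ∉ FE → e ∈ (G.deleteEdges FE).edgeSet := by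
    intro e he heF
    rw [SimpleGraph.edgeSet_deleteEdges]
    exact ⟨he, heF⟩
  refine ⟨f, fun e he => ?_, fun e he e' he' hne hv => ?_⟩
  · by_cases heF : e ∈ FE
    · obtain ⟨p, hp, rfl⟩ := heF
      rw [hfg _ p hp rfl]
      exact (mem_sdiff.1 (hgL p hp)).1
    · rw [hff e heF]
      exact hf₀L e (hrest e he heF)
  · obtain ⟨v, hv, hv'⟩ := hv
    by_cases heF : e ∈ FE <;> by_cases heF' : e' ∈ FE
    · obtain ⟨p, hp, rfl⟩ := heF
      obtain ⟨q, hq, rfl⟩ := heF'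
      rw [hfg _ p hp rfl, hfg _ q hq rfl]
      refine hg p hp q hq (fun hpq => hne (by rw [hpq])) ?_
      rcases Sym2.mem_iff.1 hv with h1 | h1 <;> rcases Sym2.mem_iff.1 hv' with h2 | h2
      · exact Or.inl (h1.symm.trans h2)
      · exact absurd (h1.symm.trans h2 ▸ hA p hp) (hA' q hq)
      · exact absurd (h2.symm.trans h1 ▸ hA q hq) (hA' p hp)
      · exact Or.inr (h1.symm.trans h2)
    · obtain ⟨p, hp, rfl⟩ := heF
      rw [hfg _ p hp rfl, hff e' heF']
      exact fun heq => hgX p hp v hv (heq ▸ hXmem v e' (hrest e' he' heF') hv')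
    · obtain ⟨p, hp, rfl⟩ := heF'
      rw [hfg _ p hp rfl, hff e heF]
      exact fun heq => hgX p hp v hv' (heq ▸ hXmem v e (hrest e he heF) hv)
    · rw [hff e heF, hff e' heF']
      exact hf₀ e (hrest e he heF) e' (hrest e' he' heF') hne ⟨v, hv, hv'⟩

theorem ListEdgeCritical.lt_degree_add_degree [Fintype V] {G : SimpleGraph V}
    [DecidableRel G.Adj] {k : ℕ} (h : ListEdgeCritical G k) {u v : V} (huv : G.Adj u v) :
    k + 2 ≤ G.degree u + G.degree v := by
  have h1 := h.exists_lt_of_bipartite {u} {(u, v)} (by simp) (by simpa using huv) (by simp)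
    (by simpa using huv.ne')
  simp only [mem_singleton, exists_eq_left, filter_singleton, if_true, card_singleton,
    max_self] at h1
  have h2 : 0 < G.degree u := (G.degree_pos_iff_exists_adj u).2 ⟨v, huv⟩
  have h3 : 0 < G.degree v := (G.degree_pos_iff_exists_adj v).2 ⟨u, huv.symm⟩
  omega

/-- Each low-degree vertex `u ∈ A` with at most one neighbor in `D` lies in a bipartite subgraph
avoiding `D`; some high-degree vertex outside `D` has few neighbors among these vertices. -/
theorem ListEdgeCritical.exists_few_neighbors [Fintype V] {G : SimpleGraph V}
    [DecidableRel G.Adj] {Δ a : ℕ} (h : ListEdgeCritical G (Δ + 1))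
    (hΔ : ∀ v, G.degree v ≤ Δ) (ha : 2 * a ≤ Δ + 2) (A D : Finset V)
    (hA : ∀ u ∈ A, 3 ≤ G.degree u ∧ G.degree u ≤ a)
    (hu : ∃ u ∈ A, #(G.neighborFinset u ∩ D) ≤ 1) :
    ∃ w, w ∉ D ∧ Δ + 3 ≤ G.degree w + a ∧
      #{u ∈ A | #(G.neighborFinset u ∩ D) ≤ 1 ∧ G.Adj u w} ≤ a + G.degree w - Δ - 2 := by
  set F : Finset (V × V) :=
    {p | p.1 ∈ A ∧ #(G.neighborFinset p.1 ∩ D) ≤ 1 ∧ G.Adj p.1 p.2 ∧ p.2 ∉ D} with hFdef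
  have hF : ∀ p, p ∈ F ↔
      p.1 ∈ A ∧ #(G.neighborFinset p.1 ∩ D) ≤ 1 ∧ G.Adj p.1 p.2 ∧ p.2 ∉ D := by
    simp [hFdef]
  have hhigh : ∀ p ∈ F, Δ + 3 ≤ G.degree p.2 + a := by
    intro p hp
    have h1 := (hF p).1 hp
    have := h.lt_degree_add_degree h1.2.2.1
    have := (hA _ h1.1).2
    omega
  have hFne : F.Nonempty := by
    obtain ⟨u, huA, hu⟩ := hu
    have h1 := (hA u huA).1
    rw [← SimpleGraph.card_neighborFinset_eq_degree] at h1
    have h2 := card_sdiff_add_card_inter (G.neighborFinset u) D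
    obtain ⟨w, hw⟩ : (G.neighborFinset u \ D).Nonempty := card_pos.1 (by omega)
    rw [mem_sdiff, SimpleGraph.mem_neighborFinset] at hw
    exact ⟨(u, w), (hF _).2 ⟨huA, hu, hw⟩⟩
  obtain ⟨p, hp, hlt⟩ := h.exists_lt_of_bipartite A F hFne (fun p hp => ((hF p).1 hp).2.2.1)
    (fun p hp => ((hF p).1 hp).1) (fun p hp hpA => by
      have := hhigh p hp
      have := (hA _ hpA).2
      omega)
  obtain ⟨hpA, hpD, hpadj, hpn⟩ := (hF p).1 hp
  refine ⟨p.2, hpn, hhigh p hp, ?_⟩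
  have hl : #{q ∈ F | q.1 = p.1} + #(G.neighborFinset p.1 ∩ D) = G.degree p.1 := by
    rw [← SimpleGraph.card_neighborFinset_eq_degree,
      ← card_sdiff_add_card_inter (G.neighborFinset p.1) D]
    congr 1
    refine card_bij (fun q _ => q.2) ?_ ?_ ?_
    · intro q hq
      obtain ⟨hq, hq1⟩ := mem_filter.1 hq
      have := (hF q).1 hq
      simpa [← hq1] using this.2.2
    · intro q hq q' hq' h1
      exact Prod.ext ((mem_filter.1 hq).2.trans (mem_filter.1 hq').2.symm) h1
    · intro x hx
      rw [mem_sdiff, SimpleGraph.mem_neighborFinset] at hx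
      exact ⟨(p.1, x), mem_filter.2 ⟨(hF _).2 ⟨hpA, hpD, hx⟩, rfl⟩, rfl⟩
  have hr : #{q ∈ F | q.2 = p.2} =
      #{u ∈ A | #(G.neighborFinset u ∩ D) ≤ 1 ∧ G.Adj u p.2} := by
    refine card_bij (fun q _ => q.1) ?_ ?_ ?_
    · intro q hq
      obtain ⟨hq, hq1⟩ := mem_filter.1 hq
      have := (hF q).1 hq
      exact mem_filter.2 ⟨this.1, this.2.1, hq1 ▸ this.2.2.1⟩
    · intro q hq q' hq' h1
      exact Prod.ext h1 ((mem_filter.1 hq).2.trans (mem_filter.1 hq').2.symm)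
    · intro x hx
      obtain ⟨h1, h2, h3⟩ := mem_filter.1 hx
      exact ⟨(x, p.2), mem_filter.2 ⟨(hF _).2 ⟨h1, h2, h3, hpn⟩, rfl⟩, rfl⟩
  have hrle : #{q ∈ F | q.2 = p.2} ≤ G.degree p.2 := by
    rw [hr, ← SimpleGraph.card_neighborFinset_eq_degree]
    refine card_le_card fun x hx => ?_
    simpa using (mem_filter.1 hx).2.2.symm
  have h1 := hΔ p.2
  have h2 := (hA _ hpA).2
  rw [← hr]
  omega

theorem ListEdgeCritical.two_mul_card_lt [Fintype V] {G : SimpleGraph V}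
    [DecidableRel G.Adj] {Δ a : ℕ} (h : ListEdgeCritical G (Δ + 1))
    (hΔ : ∀ v, G.degree v ≤ Δ) (ha : 2 * a ≤ Δ + 2) (A B : Finset V)
    (hA : ∀ u ∈ A, 3 ≤ G.degree u ∧ G.degree u ≤ a)
    (hB : ∀ w, w ∈ B ↔ Δ + 3 ≤ G.degree w + a) (D : Finset V) (hDB : D ⊆ B)
    (hD : ∑ u ∈ A, min 2 #(G.neighborFinset u ∩ D) ≤ ∑ w ∈ D, (a + G.degree w - Δ - 2))
    (hu : ∃ u ∈ A, #(G.neighborFinset u ∩ D) ≤ 1) :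
    2 * #A < ∑ w ∈ B, (a + G.degree w - Δ - 2) := by
  induction hn : #(B \ D) using Nat.strong_induction_on generalizing D with
  | _ n ih =>
    obtain ⟨w, hwD, hw, hcard⟩ := h.exists_few_neighbors hΔ ha A D hA hu
    have hwB : w ∈ B := (hB w).2 hw
    have hsub : insert w D ⊆ B := insert_subset hwB hDB
    have hsum : ∑ u ∈ A, min 2 #(G.neighborFinset u ∩ insert w D) ≤
        ∑ x ∈ insert w D, (a + G.degree x - Δ - 2) := by
      rw [sum_insert hwD]
      have hle : ∑ u ∈ A, min 2 #(G.neighborFinset u ∩ insert w D) ≤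
          ∑ u ∈ A, (min 2 #(G.neighborFinset u ∩ D) +
            if #(G.neighborFinset u ∩ D) ≤ 1 ∧ G.Adj u w then 1 else 0) := by
        refine sum_le_sum fun u _ => ?_
        by_cases huw : G.Adj u w
        · rw [inter_insert_of_mem (by simpa using huw)]
          have := card_insert_le w (G.neighborFinset u ∩ D)
          by_cases h1 : #(G.neighborFinset u ∩ D) ≤ 1
          · simp only [h1, huw, and_self, if_true]
            omega
          · simp only [h1, false_and, if_false]
            omega
        · rw [inter_insert_of_notMem (by simpa using huw)]
          exact Nat.le_add_right _ _
      rw [sum_add_distrib, ← card_filter] at hle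
      omega
    by_cases hu' : ∃ u ∈ A, #(G.neighborFinset u ∩ insert w D) ≤ 1
    · refine ih _ ?_ (insert w D) hsub hsum hu' rfl
      rw [← hn]
      refine card_lt_card ((ssubset_iff_of_subset
        (sdiff_subset_sdiff subset_rfl (subset_insert _ _))).2 ⟨w, ?_, ?_⟩)
      · exact mem_sdiff.2 ⟨hwB, hwD⟩
      · simp
    · push Not at hu'
      have h2 : 2 * #A = ∑ u ∈ A, min 2 #(G.neighborFinset u ∩ insert w D) := by
        rw [sum_congr rfl fun u hu => min_eq_left (hu' u hu), sum_const, smul_eq_mul, mul_comm]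
      rw [h2]
      refine hsum.trans_lt ?_
      obtain ⟨u, huA, hu⟩ := hu
      have h3 := (hA u huA).1
      have h4 : #(G.neighborFinset u ∩ insert w D) ≤ #(G.neighborFinset u ∩ D) + 1 :=
        (card_le_card (by
          intro x
          simp only [mem_inter, mem_insert]
          tauto)).trans (card_insert_le w _)
      rw [← SimpleGraph.card_neighborFinset_eq_degree] at h3
      have h5 := card_sdiff_add_card_inter (G.neighborFinset u) (insert w D)
      obtain ⟨x, hx⟩ : (G.neighborFinset u \ insert w D).Nonempty := card_pos.1 (by omega)
      rw [mem_sdiff, SimpleGraph.mem_neighborFinset] at hx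
      have h6 := h.lt_degree_add_degree hx.1
      have h7 := (hA u huA).2
      have h8 : Δ + 3 ≤ G.degree x + a := by omega
      exact sum_lt_sum_of_subset hsub ((hB x).2 h8) hx.2 (by omega) fun _ _ _ => Nat.zero_le _

end Critical

theorem stmt_4 {V : Type*} [Fintype V] (G : SimpleGraph V) [DecidableRel G.Adj]
    (Δ : ℕ) (hΔ : G.maxDegree = Δ)
    (hcrit : ListEdgeCritical G (Δ + 1))
    (a : ℕ) (ha3 : 3 ≤ a) (hac : a ≤ Δ / 2 + 1) :
    2 * ∑ i ∈ Finset.Icc 3 a,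
        (Finset.univ.filter fun v : V => G.degree v = i).card <
      ∑ j ∈ Finset.Icc (Δ - a + 3) Δ,
        (a + j - Δ - 2) * (Finset.univ.filter fun v : V => G.degree v = j).card := by
  have hdeg : ∀ v, G.degree v ≤ Δ := fun v => hΔ ▸ G.degree_le_maxDegree v
  have hne : Nonempty V := by
    by_contra hV
    rw [not_nonempty_iff] at hV
    refine hcrit.not_colorable fun L _ => ⟨0, fun e => ?_, fun e => ?_⟩ <;>
    exact isEmptyElim e
  have hl : ∑ i ∈ Finset.Icc 3 a, (Finset.univ.filter fun v : V => G.degree v = i).card =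
      (Finset.univ.filter fun v : V => G.degree v ∈ Finset.Icc 3 a).card := by
    rw [Finset.card_eq_sum_card_fiberwise (f := fun v => G.degree v) (t := Finset.Icc 3 a)
      (fun v hv => by simpa using hv)]
    refine Finset.sum_congr rfl fun i hi => ?_
    rw [Finset.filter_filter]
    congr 1
    ext v
    simp only [Finset.mem_filter, Finset.mem_univ, true_and]
    exact ⟨fun h => ⟨h ▸ hi, h⟩, fun h => h.2⟩
  have hr : ∑ j ∈ Finset.Icc (Δ - a + 3) Δ,
        (a + j - Δ - 2) * (Finset.univ.filter fun v : V => G.degree v = j).card =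
      ∑ w ∈ Finset.univ.filter fun v : V => G.degree v ∈ Finset.Icc (Δ - a + 3) Δ,
        (a + G.degree w - Δ - 2) := by
    rw [← Finset.sum_fiberwise_of_maps_to (g := fun v => G.degree v)
      (t := Finset.Icc (Δ - a + 3) Δ) (fun v hv => (Finset.mem_filter.1 hv).2)]
    refine Finset.sum_congr rfl fun j hj => ?_
    rw [Finset.filter_filter, Finset.sum_congr rfl
      (g := fun _ => a + j - Δ - 2) (fun v hv => by rw [(Finset.mem_filter.1 hv).2.2]),
      Finset.sum_const, smul_eq_mul, mul_comm]
    congr 2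
    ext v
    simp only [Finset.mem_filter, Finset.mem_univ, true_and]
    exact ⟨fun h => ⟨h ▸ hj, h⟩, fun h => h.2⟩
  rw [hl, hr]
  rcases (Finset.univ.filter fun v : V => G.degree v ∈ Finset.Icc 3 a).eq_empty_or_nonempty
    with hA | ⟨u, hu⟩
  · rw [hA, Finset.card_empty, mul_zero]
    obtain ⟨v, hv⟩ := G.exists_maximal_degree_vertex
    rw [hΔ] at hv
    refine Finset.sum_pos' (fun _ _ => Nat.zero_le _) ⟨v, ?_, ?_⟩
    · simp only [Finset.mem_filter, Finset.mem_univ, true_and, Finset.mem_Icc]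
      omega
    · omega
  · refine hcrit.two_mul_card_lt hdeg (by omega) _ _ (fun v hv => by simpa using hv)
      (fun w => ?_) ∅ (Finset.empty_subset _) (by simp) ⟨u, hu, by simp⟩
    have := hdeg w
    simp only [Finset.mem_filter, Finset.mem_univ, true_and, Finset.mem_Icc]
    omega
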